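/- arXiv:math/0503074 — 2 statements merged into one kernel-verified Lean document; each statement's English description precedes it below -/
import Mathlib

section
/- With the skew product ⟨f,g⟩ = ∑_{y=0}^∞ q^{y/2} α^{-y/2} f(y) ∑_{x=y+1}^∞ q^{x/2} α^{x/2} g(x) − (f ↔ g), and C_n the monic Meixner polynomials C_n(x) = (n! q^n/(q-1)^n) M_n(x;1,q), one has for m < n the factorization ⟨C_m, C_n⟩ = a_m b_n, where a_n = n! · (√α/(√α - √q)) · (√q(1-√(αq))/((1-q)(√α-√q)))^n and b_n = n! · (1/(1-√(αq))) · (√q(√α-√q)/((1-q)(1-√(αq))))^n, valid for 0 < q < 1 and 0 < αq < 1 with √α ≠ √q. -/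
open scoped BigOperators

/-- The Pochhammer symbol `(a)_k = a(a+1)⋯(a+k-1)` for real `a`. -/
noncomputable def poch (a : ℝ) (k : ℕ) : ℝ := ∏ i ∈ Finset.range k, (a + i)

/-- The Meixner polynomial `M_n(x;c,q) = ₂F₁(-n,-x;c;1-1/q)` (terminating sum). -/
noncomputable def meixner (n : ℕ) (x : ℝ) (c q : ℝ) : ℝ :=
  ∑ k ∈ Finset.range (n + 1),
    poch (-(n : ℝ)) k * poch (-x) k / (poch c k * (k.factorial : ℝ)) * (1 - 1 / q) ^ k

/-- The monic Meixner-type polynomial `C_n(x) = (n! qⁿ/(q-1)ⁿ) M_n(x;1,q)`. -/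
noncomputable def meixnerC (q : ℝ) (n : ℕ) (x : ℝ) : ℝ :=
  ((n.factorial : ℝ) * q ^ n / (q - 1) ^ n) * meixner n x 1 q

open Polynomial in
/-- A polynomial times a geometric sequence of ratio less than one is summable. -/
lemma summable_geometric_mul_polynomial_eval {r : ℝ} (hr : |r| < 1) (p : ℝ[X]) :
    Summable fun y : ℕ => r ^ y * p.eval (y : ℝ) := by
  simp_rw [eval_eq_sum_range, Finset.mul_sum]
  refine summable_sum fun k _ => ?_
  refine ((summable_pow_mul_geometric_of_norm_lt_one k
    (by simpa using hr : ‖r‖ < 1)).mul_left (p.coeff k)).congr fun y => ?_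
  ring

open Polynomial in
lemma exists_polynomial_eval_eq_meixner (q : ℝ) (n : ℕ) :
    ∃ p : ℝ[X], ∀ x : ℝ, meixner n x 1 q = p.eval x := by
  refine ⟨∑ k ∈ Finset.range (n + 1),
    C (poch (-(n : ℝ)) k / (poch 1 k * (k.factorial : ℝ)) * (1 - 1 / q) ^ k) *
      ∏ i ∈ Finset.range k, (-X + C (i : ℝ)), fun x => ?_⟩
  simp only [meixner, eval_finsetSum, eval_mul, eval_C, eval_prod, eval_add, eval_neg, eval_X]
  refine Finset.sum_congr rfl fun k _ => ?_
  rw [← poch]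
  ring

lemma summable_geometric_mul_meixner {r : ℝ} (hr : |r| < 1) (q : ℝ) (n : ℕ) :
    Summable fun y : ℕ => r ^ y * meixner n y 1 q := by
  obtain ⟨p, hp⟩ := exists_polynomial_eval_eq_meixner q n
  simpa only [hp] using summable_geometric_mul_polynomial_eval hr p

lemma summable_geometric_mul_meixner_mul_meixner {r : ℝ} (hr : |r| < 1) (q : ℝ) (m n : ℕ) :
    Summable fun y : ℕ => r ^ y * (meixner m y 1 q * meixner n y 1 q) := by
  obtain ⟨p, hp⟩ := exists_polynomial_eval_eq_meixner q m
  obtain ⟨p', hp'⟩ := exists_polynomial_eval_eq_meixner q n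
  simpa only [hp, hp', Polynomial.eval_mul] using
    summable_geometric_mul_polynomial_eval hr (p * p')

lemma poch_neg_natCast (n k : ℕ) :
    poch (-(n : ℝ)) k = (-1) ^ k * ((k.factorial : ℝ) * (n.choose k : ℝ)) := by
  rw [← Nat.cast_mul, ← Nat.descFactorial_eq_factorial_mul_choose]
  induction k with
  | zero => simp [poch]
  | succ k ih =>
    rw [poch, Finset.prod_range_succ, ← poch, ih, Nat.descFactorial_succ]
    rcases le_or_gt k n with h | h
    · push_cast [Nat.cast_sub h]
      ring
    · simp [Nat.descFactorial_of_lt h]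

lemma poch_one (k : ℕ) : poch 1 k = (k.factorial : ℝ) := by
  induction k with
  | zero => simp [poch]
  | succ k ih =>
    rw [poch, Finset.prod_range_succ, ← poch, ih, Nat.factorial_succ]
    push_cast
    ring

/-- At natural arguments, the Meixner polynomial with `c = 1` is a sum of products of binomial
coefficients; the range of summation may be enlarged. -/
lemma meixner_natCast (q : ℝ) {n N : ℕ} (hN : n ≤ N) (x : ℕ) :
    meixner n x 1 q =
      ∑ k ∈ Finset.range (N + 1), (n.choose k : ℝ) * (x.choose k : ℝ) * (1 - 1 / q) ^ k := by
  rw [← Finset.sum_subset (Finset.range_mono (Nat.succ_le_succ hN))]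
  · refine Finset.sum_congr rfl fun k _ => ?_
    rw [poch_neg_natCast, poch_neg_natCast, poch_one]
    have hk : (k.factorial : ℝ) ≠ 0 := by positivity
    have hs : ((-1 : ℝ) ^ k) * (-1) ^ k = 1 := by rw [← mul_pow]; simp
    generalize 1 - 1 / q = z
    field_simp
    linear_combination (n.choose k : ℝ) * (x.choose k : ℝ) * z ^ k * hs
  · intro k _ hk
    rw [Nat.choose_eq_zero_of_lt (by simpa using hk)]
    simp

lemma meixner_zero_left (q x : ℝ) : meixner 0 x 1 q = 1 := by
  simp [meixner, poch]

lemma meixner_zero_right (q : ℝ) (n : ℕ) : meixner n 0 1 q = 1 := by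
  have h := meixner_natCast q le_rfl 0 (n := n)
  rw [Finset.sum_range_succ'] at h
  simpa using h

/-- The mixed degree-argument recurrence of the Meixner polynomials with `c = 1`. -/
lemma meixner_succ_sub_meixner_succ (q : ℝ) (n x : ℕ) :
    meixner (n + 1) ((x + 1 : ℕ) : ℝ) 1 q - meixner n ((x + 1 : ℕ) : ℝ) 1 q =
      meixner (n + 1) x 1 q - meixner n x 1 q / q := by
  have key : meixner (n + 1) ((x + 1 : ℕ) : ℝ) 1 q - meixner n ((x + 1 : ℕ) : ℝ) 1 q
      - meixner (n + 1) x 1 q + meixner n x 1 q = (1 - 1 / q) * meixner n x 1 q := by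
    rw [meixner_natCast q le_rfl x (n := n), Finset.mul_sum,
      ← meixner_natCast q le_rfl x (n := n), meixner_natCast q le_rfl (n := n + 1),
      meixner_natCast q le_rfl (n := n + 1), meixner_natCast q n.le_succ,
      meixner_natCast q n.le_succ, ← Finset.sum_sub_distrib, ← Finset.sum_sub_distrib,
      ← Finset.sum_add_distrib, Finset.sum_range_succ']
    simp only [Nat.choose_succ_succ, Nat.choose_zero_right]
    push_cast
    rw [add_eq_left.2 (by ring)]
    exact Finset.sum_congr rfl fun k _ => by ring
  linear_combination key

/-- Orthogonality of the Meixner polynomials with `c = 1`. -/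
lemma tsum_geometric_mul_meixner_mul_meixner {q : ℝ} (hq0 : 0 < q) (hq1 : q < 1) (m n : ℕ) :
    ∑' y : ℕ, q ^ y * (meixner m y 1 q * meixner n y 1 q) =
      if m = n then (q ^ n)⁻¹ / (1 - q) else 0 := by
  have hq : |q| < 1 := by rwa [abs_of_pos hq0]
  have hq1' : 1 - q ≠ 0 := by linarith
  set A : ℕ → ℕ → ℝ := fun i j => ∑' y : ℕ, q ^ y * (meixner i y 1 q * meixner j y 1 q) with hA
  have hs : ∀ i j, HasSum (fun y : ℕ => q ^ y * (meixner i y 1 q * meixner j y 1 q)) (A i j) :=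
    fun i j => (summable_geometric_mul_meixner_mul_meixner hq q i j).hasSum
  have hcomm : ∀ i j, A i j = A j i := fun i j => by simp only [hA, mul_comm (meixner i _ _ _)]
  have hzero : ∀ j, A 0 (j + 1) = 0 := by
    intro j
    have h1 := (hasSum_nat_add_iff' 1).2 ((hs 0 (j + 1)).sub (hs 0 j))
    have h2 := ((hs 0 (j + 1)).sub ((hs 0 j).div_const q)).mul_left q
    have h := h1.unique (h2.congr_fun fun y => ?_)
    · simp only [Finset.sum_range_one, Nat.cast_zero, meixner_zero_right, sub_self, sub_zero] at h
      have : (1 - q) * A 0 (j + 1) = 0 := by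
        field_simp at h
        linear_combination h
      exact (mul_eq_zero.1 this).resolve_left hq1'
    · have := meixner_succ_sub_meixner_succ q j y
      simp only [meixner_zero_left]
      rw [pow_succ]
      linear_combination q ^ y * q * this
  have hsucc : ∀ i j, A (i + 1) (j + 1) = A i j / q := by
    intro i j
    have h1 := (hasSum_nat_add_iff' 1).2
      (((hs (i + 1) (j + 1)).sub (hs i (j + 1))).sub ((hs (i + 1) j).sub (hs i j)))
    have h2 := (((hs (i + 1) (j + 1)).sub ((hs i (j + 1)).div_const q)).sub
      (((hs (i + 1) j).sub ((hs i j).div_const q)).div_const q)).mul_left q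
    have h := h1.unique (h2.congr_fun fun y => ?_)
    · simp only [Finset.sum_range_one, Nat.cast_zero, meixner_zero_right, sub_self, sub_zero] at h
      have : (1 - q) * (A (i + 1) (j + 1) - A i j / q) = 0 := by
        field_simp at h ⊢
        linear_combination h
      exact sub_eq_zero.1 ((mul_eq_zero.1 this).resolve_left hq1')
    · have hi := meixner_succ_sub_meixner_succ q i y
      have hj := meixner_succ_sub_meixner_succ q j y
      rw [pow_succ]
      linear_combination q ^ y * q *
        ((meixner (j + 1) ((y + 1 : ℕ) : ℝ) 1 q - meixner j ((y + 1 : ℕ) : ℝ) 1 q) * hi +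
          (meixner (i + 1) y 1 q - meixner i y 1 q / q) * hj)
  change A m n = _
  induction n generalizing m with
  | zero =>
    cases m with
    | zero => simp [hA, meixner_zero_left, tsum_geometric_of_lt_one hq0.le hq1]
    | succ m => rw [hcomm, hzero]; simp
  | succ n ih =>
    cases m with
    | zero => rw [hzero]; simp
    | succ m =>
      rw [hsucc, ih]
      simp only [add_left_inj]
      split_ifs
      · rw [pow_succ]
        field_simp
      · simp

/-- The tail sums `∑_{x > y} vˣ M_n(x)`. -/
noncomputable def meixnerTail (q v : ℝ) (n y : ℕ) : ℝ :=
  ∑' x : ℕ, v ^ (y + 1 + x) * meixner n ((y + 1 + x : ℕ) : ℝ) 1 q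

lemma meixnerTail_zero {v : ℝ} (hv : |v| < 1) (q : ℝ) (y : ℕ) :
    meixnerTail q v 0 y = v ^ (y + 1) / (1 - v) := by
  simp only [meixnerTail, meixner_zero_left, mul_one, pow_add v (y + 1)]
  rw [tsum_mul_left, tsum_geometric_of_norm_lt_one (by simpa using hv)]
  rfl

/-- A two-term combination of consecutive tail sums telescopes. -/
lemma meixnerTail_succ {v : ℝ} (hv : |v| < 1) (q : ℝ) (n y : ℕ) :
    meixnerTail q v (n + 1) y = (1 - v / q) / (1 - v) * meixnerTail q v n y +
      v ^ (y + 1) / (1 - v) * (meixner (n + 1) y 1 q - meixner n y 1 q / q) := by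
  have hv1 : 1 - v ≠ 0 := by linarith [(abs_lt.1 hv).2]
  have hs : ∀ k, Summable fun x : ℕ =>
      v ^ (y + 1 + x) * meixner k ((y + 1 + x : ℕ) : ℝ) 1 q := fun k =>
    (summable_geometric_mul_meixner hv q k).comp_injective (add_right_injective (y + 1))
  set F : ℕ → ℝ := fun x =>
    v ^ (x + 1) / (1 - v) * (meixner (n + 1) x 1 q - meixner n x 1 q / q) with hF
  have hFs : Summable F :=
    (((summable_geometric_mul_meixner hv q (n + 1)).sub
      ((summable_geometric_mul_meixner hv q n).div_const q)).mul_left (v / (1 - v))).congr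
      fun x => by simp only [hF]; ring
  have hFy : Summable fun x => F (y + x) := hFs.comp_injective (add_right_injective y)
  have hsum := hFy.sum_add_tsum_nat_add 1
  have hstep : ∀ x, F (y + x) - F (y + (x + 1)) =
      v ^ (y + 1 + x) * meixner (n + 1) ((y + 1 + x : ℕ) : ℝ) 1 q -
        (1 - v / q) / (1 - v) * (v ^ (y + 1 + x) * meixner n ((y + 1 + x : ℕ) : ℝ) 1 q) := by
    intro x
    have h := meixner_succ_sub_meixner_succ q n (y + x)
    simp only [hF]
    rw [← h, show y + 1 + x = y + x + 1 by ring, show y + (x + 1) = y + x + 1 by ring,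
      pow_succ v (y + x + 1)]
    field_simp
    ring
  have htel := (hFy.hasSum.sub ((summable_nat_add_iff 1).2 hFy).hasSum).unique
    (((hs (n + 1)).hasSum.sub ((hs n).hasSum.mul_left ((1 - v / q) / (1 - v)))).congr_fun hstep)
  rw [← hsum] at htel
  simp only [Finset.sum_range_one, add_zero, add_sub_cancel_right] at htel
  change F y = meixnerTail q v (n + 1) y - _ * meixnerTail q v n y at htel
  change _ = _ + F y
  linear_combination -htel

section Pairing

variable {q u v : ℝ}

lemma hasSum_pairing_zero (hq0 : 0 < q) (hq1 : q < 1) (hv : |v| < 1) (huv : u * v = q) (m : ℕ) :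
    HasSum (fun y : ℕ => u ^ y * meixner m y 1 q * meixnerTail q v 0 y)
      (v / (1 - v) * if m = 0 then 1 / (1 - q) else 0) := by
  have h := (summable_geometric_mul_meixner_mul_meixner
    (by rwa [abs_of_pos hq0] : |q| < 1) q m 0).hasSum
  rw [tsum_geometric_mul_meixner_mul_meixner hq0 hq1] at h
  rw [pow_zero, inv_one] at h
  refine (h.mul_left (v / (1 - v))).congr_fun fun y => ?_
  have hy : q ^ y = u ^ y * v ^ y := by rw [← huv, mul_pow]
  rw [meixnerTail_zero hv, meixner_zero_left, hy]
  ring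

lemma hasSum_pairing_succ (hq0 : 0 < q) (hq1 : q < 1) (hv : |v| < 1) (huv : u * v = q)
    {m n : ℕ} {b : ℝ}
    (hb : HasSum (fun y : ℕ => u ^ y * meixner m y 1 q * meixnerTail q v n y) b) :
    HasSum (fun y : ℕ => u ^ y * meixner m y 1 q * meixnerTail q v (n + 1) y)
      ((1 - v / q) / (1 - v) * b + v / (1 - v) *
        ((if m = n + 1 then (q ^ (n + 1))⁻¹ / (1 - q) else 0) -
          (if m = n then (q ^ n)⁻¹ / (1 - q) else 0) / q)) := by
  have h := fun k => (summable_geometric_mul_meixner_mul_meixner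
    (by rwa [abs_of_pos hq0] : |q| < 1) q m k).hasSum
  simp only [tsum_geometric_mul_meixner_mul_meixner hq0 hq1] at h
  refine ((hb.mul_left ((1 - v / q) / (1 - v))).add
    (((h (n + 1)).sub ((h n).div_const q)).mul_left (v / (1 - v)))).congr_fun fun y => ?_
  have hy : q ^ y = u ^ y * v ^ y := by rw [← huv, mul_pow]
  rw [meixnerTail_succ hv, hy]
  ring

lemma hasSum_pairing_of_lt (hq0 : 0 < q) (hq1 : q < 1) (hv : |v| < 1) (huv : u * v = q)
    {m n : ℕ} (hmn : n < m) :
    HasSum (fun y : ℕ => u ^ y * meixner m y 1 q * meixnerTail q v n y) 0 := by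
  induction n with
  | zero => simpa [hmn.ne'] using hasSum_pairing_zero hq0 hq1 hv huv m
  | succ n ih =>
    simpa [hmn.ne', (Nat.lt_of_succ_lt hmn).ne'] using
      hasSum_pairing_succ hq0 hq1 hv huv (ih (Nat.lt_of_succ_lt hmn))

lemma hasSum_pairing_self (hq0 : 0 < q) (hq1 : q < 1) (hv : |v| < 1) (huv : u * v = q) (m : ℕ) :
    HasSum (fun y : ℕ => u ^ y * meixner m y 1 q * meixnerTail q v m y)
      (v / (1 - v) * ((q ^ m)⁻¹ / (1 - q))) := by
  cases m with
  | zero => simpa using hasSum_pairing_zero hq0 hq1 hv huv 0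
  | succ m =>
    simpa using hasSum_pairing_succ hq0 hq1 hv huv
      (hasSum_pairing_of_lt hq0 hq1 hv huv m.lt_succ_self)

lemma hasSum_pairing_add_succ (hq0 : 0 < q) (hq1 : q < 1) (hv : |v| < 1) (huv : u * v = q)
    (m j : ℕ) :
    HasSum (fun y : ℕ => u ^ y * meixner m y 1 q * meixnerTail q v (m + 1 + j) y)
      (-(v / q) / (1 - v) ^ 2 * (q ^ m)⁻¹ * ((1 - v / q) / (1 - v)) ^ j) := by
  have hv1 : 1 - v ≠ 0 := by linarith [(abs_lt.1 hv).2]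
  have hq1' : 1 - q ≠ 0 := by linarith
  induction j with
  | zero =>
    have h := hasSum_pairing_succ hq0 hq1 hv huv (hasSum_pairing_self hq0 hq1 hv huv m)
    convert h using 1
    simp only [if_true, Nat.left_eq_add, one_ne_zero, if_false]
    field_simp
    ring
  | succ j ih =>
    have h := hasSum_pairing_succ hq0 hq1 hv huv ih
    rw [if_neg (by omega), if_neg (by omega)] at h
    rw [pow_succ, ← add_assoc]
    convert h using 1
    ring

end Pairing

lemma tsum_geometric_mul_meixnerC (q v : ℝ) (n y : ℕ) :
    ∑' x : ℕ, v ^ (y + 1 + x) * meixnerC q n (y + 1 + x) =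
      (n.factorial : ℝ) * q ^ n / (q - 1) ^ n * meixnerTail q v n y := by
  rw [meixnerTail, ← tsum_mul_left]
  refine tsum_congr fun x => ?_
  rw [meixnerC]
  push_cast
  ring

/-- The iterated sum of two polynomials `C_m`, `C_n` in terms of the Meixner polynomials. -/
lemma tsum_meixnerC_mul_tsum_meixnerC (q u v : ℝ) (m n : ℕ) :
    ∑' y : ℕ, u ^ y * meixnerC q m y *
        ∑' x : ℕ, v ^ (y + 1 + x) * meixnerC q n (y + 1 + x) =
      ((m.factorial : ℝ) * q ^ m / (q - 1) ^ m * ((n.factorial : ℝ) * q ^ n / (q - 1) ^ n)) *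
        ∑' y : ℕ, u ^ y * meixner m y 1 q * meixnerTail q v n y := by
  rw [← tsum_mul_left]
  refine tsum_congr fun y => ?_
  rw [tsum_geometric_mul_meixnerC, meixnerC]
  ring

open Real in
/-- For the skew product
`⟨f,g⟩ = ∑_{y≥0} q^{y/2} α^{-y/2} f(y) ∑_{x>y} q^{x/2} α^{x/2} g(x) − (f↔g)`
and the monic Meixner polynomials `C_n`, one has for `m < n` the rank-one
factorization `⟨C_m, C_n⟩ = a_m b_n` with the explicit `a`, `b` below. -/
theorem meixnerC_skew_product_factorization (q α : ℝ)
    (hq0 : 0 < q) (hq1 : q < 1) (hαq0 : 0 < α * q) (hαq1 : α * q < 1)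
    (hne : sqrt α ≠ sqrt q) (m n : ℕ) (hmn : m < n) :
    (∑' y : ℕ, (sqrt q / sqrt α) ^ y * meixnerC q m y *
        ∑' x : ℕ, (sqrt q * sqrt α) ^ (y + 1 + x) * meixnerC q n (y + 1 + x)) -
      (∑' y : ℕ, (sqrt q / sqrt α) ^ y * meixnerC q n y *
        ∑' x : ℕ, (sqrt q * sqrt α) ^ (y + 1 + x) * meixnerC q m (y + 1 + x)) =
    ((m.factorial : ℝ) * (sqrt α / (sqrt α - sqrt q)) *
        (sqrt q * (1 - sqrt (α * q)) / ((1 - q) * (sqrt α - sqrt q))) ^ m) *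
      ((n.factorial : ℝ) * (1 / (1 - sqrt (α * q))) *
        (sqrt q * (sqrt α - sqrt q) / ((1 - q) * (1 - sqrt (α * q)))) ^ n) := by
  have hα : 0 < α := pos_of_mul_pos_left hαq0 hq0.le
  rw [sqrt_mul hα.le]
  have hv1 : sqrt q * sqrt α < 1 := by
    rw [← sqrt_mul hq0.le, mul_comm q, sqrt_lt' one_pos]
    simpa using hαq1
  have hs0 : 0 < sqrt q := sqrt_pos.2 hq0
  have ha0 : 0 < sqrt α := sqrt_pos.2 hα
  have hsq : sqrt q ^ 2 = q := sq_sqrt hq0.le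
  have hv : |sqrt q * sqrt α| < 1 := by rwa [abs_of_pos (by positivity)]
  have huv : sqrt q / sqrt α * (sqrt q * sqrt α) = q := by
    field_simp
    exact hsq
  obtain ⟨j, rfl⟩ := Nat.exists_eq_add_of_lt hmn
  rw [show m + j + 1 = m + 1 + j by ring] at hmn ⊢
  rw [tsum_meixnerC_mul_tsum_meixnerC, tsum_meixnerC_mul_tsum_meixnerC,
    (hasSum_pairing_of_lt hq0 hq1 hv huv hmn).tsum_eq,
    (hasSum_pairing_add_succ hq0 hq1 hv huv m j).tsum_eq]
  generalize sqrt q = s at *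
  generalize sqrt α = a at *
  subst hsq
  have h1 : a - s ≠ 0 := sub_ne_zero.2 hne
  have h2 : 1 - s * a ≠ 0 := by linarith
  have h3 : 1 - s ^ 2 ≠ 0 := by linarith
  have h4 : s ^ 2 - 1 ≠ 0 := by linarith
  rw [mul_comm a s]
  set N := s * (a - s) / ((1 - s ^ 2) * (1 - s * a)) with hN
  set P := s * (1 - s * a) / ((1 - s ^ 2) * (a - s)) with hP
  set r := (1 - s * a / s ^ 2) / (1 - s * a) with hr
  set Q := s ^ 2 / (s ^ 2 - 1) with hQ
  have hQN : r * Q = N := by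
    rw [hr, hQ, hN, show s ^ 2 - 1 = -(1 - s ^ 2) by ring]
    field_simp
    ring
  have hPN : P * N = Q ^ 2 * (s ^ 2)⁻¹ := by
    rw [hP, hQ, hN, show s ^ 2 - 1 = -(1 - s ^ 2) by ring]
    field_simp
  have hpref : -(s * a / s ^ 2) / (1 - s * a) ^ 2 * Q =
      a / (a - s) * (1 / (1 - s * a)) * N := by
    rw [hQ, hN, show s ^ 2 - 1 = -(1 - s ^ 2) by ring]
    field_simp
  have hpow : P ^ m * N ^ m = Q ^ m * Q ^ m * ((s ^ 2) ^ m)⁻¹ := by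
    rw [← mul_pow, hPN, mul_pow, inv_pow]
    ring
  have hpowj : r ^ j * Q ^ j = N ^ j := by rw [← mul_pow, hQN]
  rw [mul_div_assoc, ← div_pow, mul_div_assoc, ← div_pow, ← hQ, pow_add N, pow_add N,
    pow_add Q, pow_add Q, pow_one, pow_one]
  linear_combination (m.factorial : ℝ) * ((m + 1 + j).factorial : ℝ) *
    (Q ^ m * Q ^ m * ((s ^ 2) ^ m)⁻¹ * (r ^ j * Q ^ j * hpref +
        a / (a - s) * (1 / (1 - s * a)) * N * hpowj) -
      a / (a - s) * (1 / (1 - s * a)) * N * N ^ j * hpow)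
end

section
/- The Airy kernel admits the integral representation (Ai(x)Ai'(y) − Ai(y)Ai'(x))/(x−y) = ∫_0^∞ Ai(x+t) Ai(y+t) dt for x ≠ y. -/
open MeasureTheory Filter Topology

/-- The Airy phase function `z ↦ exp (i (z³ / 3 + x z))`. -/
noncomputable def airyPhase (x : ℝ) (z : ℂ) : ℂ :=
  Complex.exp (Complex.I * (z ^ 3 / 3 + x * z))

/-- The moments `∫ zⁿ exp (i (z³ / 3 + x z)) dz` of the Airy phase over the line `Im z = 1`. -/
noncomputable def airyMoment (n : ℕ) (x : ℝ) : ℂ :=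
  ∫ s : ℝ, ((s : ℂ) + Complex.I) ^ n * airyPhase x (s + Complex.I)

theorem differentiable_airyPhase (x : ℝ) : Differentiable ℂ (airyPhase x) := by
  unfold airyPhase
  fun_prop

@[fun_prop]
theorem continuous_airyPhase (x : ℝ) : Continuous (airyPhase x) :=
  (differentiable_airyPhase x).continuous

theorem hasDerivAt_airyPhase (x : ℝ) (z : ℂ) :
    HasDerivAt (airyPhase x) (Complex.I * (z ^ 2 + x) * airyPhase x z) z := by
  have h : HasDerivAt (fun z : ℂ => Complex.I * (z ^ 3 / 3 + x * z))
      (Complex.I * (z ^ 2 + x)) z := by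
    convert! (((hasDerivAt_pow 3 z).div_const 3).add
      ((hasDerivAt_id z).const_mul (x : ℂ))).const_mul Complex.I using 1
    norm_num
  rw [mul_comm]
  exact h.cexp

theorem norm_airyPhase (x a b : ℝ) :
    ‖airyPhase x (a + b * Complex.I)‖ = Real.exp (-b * a ^ 2 + b ^ 3 / 3 - x * b) := by
  rw [airyPhase, Complex.norm_exp]
  congr 1
  have h : Complex.I * (((a : ℂ) + b * Complex.I) ^ 3 / 3 + x * (a + b * Complex.I)) =
      ((-b * a ^ 2 + b ^ 3 / 3 - x * b : ℝ) : ℂ) +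
        ((a ^ 3 / 3 - a * b ^ 2 + x * a : ℝ) : ℂ) * Complex.I := by
    push_cast
    linear_combination ((a : ℂ) ^ 2 * b + x * b - b ^ 3 / 3 * (1 - Complex.I ^ 2) +
      a * b ^ 2 * Complex.I) * Complex.I_sq
  rw [h, Complex.add_re, Complex.ofReal_re, Complex.re_ofReal_mul, Complex.I_re,
    mul_zero, add_zero]

theorem norm_pow_mul_airyPhase_le {n : ℕ} (hn : n ≤ 2) (x s : ℝ) :
    ‖((s : ℂ) + Complex.I) ^ n * airyPhase x (s + Complex.I)‖ ≤
      2 * Real.exp (1 / 3 - x) * Real.exp (-(1 / 2) * s ^ 2) := by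
  have hsq : ‖(s : ℂ) + Complex.I‖ ^ 2 = 1 + s ^ 2 := by
    rw [← Complex.normSq_eq_norm_sq, Complex.normSq_apply]
    simp
    ring
  have h1 : 1 ≤ ‖(s : ℂ) + Complex.I‖ := by
    nlinarith [norm_nonneg ((s : ℂ) + Complex.I), sq_nonneg s]
  have hpow : ‖(s : ℂ) + Complex.I‖ ^ n ≤ 2 * Real.exp (s ^ 2 / 2) := by
    refine (pow_le_pow_right₀ h1 hn).trans ?_
    rw [hsq]
    linarith [Real.add_one_le_exp (s ^ 2 / 2)]
  have hphase : ‖airyPhase x (s + Complex.I)‖ =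
      Real.exp (1 / 3 - x) * Real.exp (-s ^ 2) := by
    have := norm_airyPhase x s 1
    rw [Complex.ofReal_one, one_mul] at this
    rw [this, ← Real.exp_add]
    congr 1
    ring
  rw [norm_mul, norm_pow, hphase]
  refine (mul_le_mul_of_nonneg_right hpow (by positivity)).trans_eq ?_
  have : Real.exp (-(1 / 2) * s ^ 2) = Real.exp (s ^ 2 / 2) * Real.exp (-s ^ 2) := by
    rw [← Real.exp_add]
    congr 1
    ring
  rw [this]
  ring

theorem integrable_pow_mul_airyPhase {n : ℕ} (hn : n ≤ 2) (x : ℝ) :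
    Integrable fun s : ℝ => ((s : ℂ) + Complex.I) ^ n * airyPhase x (s + Complex.I) := by
  refine ((integrable_exp_neg_mul_sq (b := 1 / 2) (by norm_num)).const_mul
    (2 * Real.exp (1 / 3 - x))).mono' (Continuous.aestronglyMeasurable (by fun_prop)) ?_
  exact ae_of_all _ (norm_pow_mul_airyPhase_le hn x)

theorem exists_norm_airyMoment_le :
    ∃ C : ℝ, ∀ n ≤ 2, ∀ x : ℝ, ‖airyMoment n x‖ ≤ C * Real.exp (-x) := by
  refine ⟨2 * Real.exp (1 / 3) * ∫ s : ℝ, Real.exp (-(1 / 2) * s ^ 2), fun n hn x => ?_⟩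
  refine (norm_integral_le_of_norm_le ((integrable_exp_neg_mul_sq (b := 1 / 2)
    (by norm_num)).const_mul (2 * Real.exp (1 / 3 - x)))
    (ae_of_all _ (norm_pow_mul_airyPhase_le hn x))).trans_eq ?_
  rw [integral_const_mul, sub_eq_add_neg, Real.exp_add]
  ring

theorem hasDerivAt_airyMoment {n : ℕ} (hn : n ≤ 1) (x : ℝ) :
    HasDerivAt (airyMoment n) (Complex.I * airyMoment (n + 1) x) x := by
  have h := (hasDerivAt_integral_of_dominated_loc_of_deriv_le (μ := volume)
    (F := fun (x : ℝ) (s : ℝ) => ((s : ℂ) + Complex.I) ^ n * airyPhase x (s + Complex.I))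
    (F' := fun (x : ℝ) (s : ℝ) =>
      Complex.I * (((s : ℂ) + Complex.I) ^ (n + 1) * airyPhase x (s + Complex.I)))
    (bound := fun s => 2 * Real.exp (1 / 3 - (x - 1)) * Real.exp (-(1 / 2) * s ^ 2))
    (Ioi_mem_nhds (sub_one_lt x))
    (Eventually.of_forall fun y => Continuous.aestronglyMeasurable (by fun_prop))
    (integrable_pow_mul_airyPhase (by lia) x)
    (Continuous.aestronglyMeasurable (by fun_prop)) ?_
    ((integrable_exp_neg_mul_sq (by norm_num)).const_mul _) ?_).2
  · rwa [integral_const_mul] at h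
  · refine ae_of_all _ fun s y hy => ?_
    rw [norm_mul, Complex.norm_I, one_mul]
    refine (norm_pow_mul_airyPhase_le (by lia) y s).trans ?_
    have : x - 1 < y := hy
    gcongr
  · refine ae_of_all _ fun s y _ => ?_
    have h : HasDerivAt (fun y : ℝ => Complex.I * (((s : ℂ) + Complex.I) ^ 3 / 3 +
        y * (s + Complex.I))) (Complex.I * (s + Complex.I)) y := by
      simpa using ((((hasDerivAt_id y).ofReal_comp).mul_const
        ((s : ℂ) + Complex.I)).const_add (((s : ℂ) + Complex.I) ^ 3 / 3)).const_mul Complex.I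
    convert! h.cexp.const_mul (((s : ℂ) + Complex.I) ^ n) using 1
    simp only [airyPhase]
    ring

theorem airyMoment_two (x : ℝ) : airyMoment 2 x = -x * airyMoment 0 x := by
  have h0 := integrable_pow_mul_airyPhase (n := 0) (by norm_num) x
  have h2 := integrable_pow_mul_airyPhase (n := 2) le_rfl x
  have hd : ∀ s : ℝ, HasDerivAt (fun s : ℝ => airyPhase x (s + Complex.I))
      (Complex.I * (((s : ℂ) + Complex.I) ^ 2 * airyPhase x (s + Complex.I) +
        x * (((s : ℂ) + Complex.I) ^ 0 * airyPhase x (s + Complex.I)))) s := by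
    intro s
    have hl : HasDerivAt (fun s : ℝ => (s : ℂ) + Complex.I) 1 s :=
      (hasDerivAt_id s).ofReal_comp.add_const _
    convert! (hasDerivAt_airyPhase x _).comp s hl using 1
    ring
  have h := integral_eq_zero_of_hasDerivAt_of_integrable hd
    ((h2.add (h0.const_mul _)).const_mul _) (by simpa using h0)
  rw [integral_const_mul, integral_add h2 (h0.const_mul _), integral_const_mul] at h
  have h' := (mul_eq_zero.mp h).resolve_left Complex.I_ne_zero
  rw [airyMoment, airyMoment]
  linear_combination h'

theorem tendsto_integral_airyPhase_vertical (x : ℝ) {u : ℝ → ℝ}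
    (hu : Tendsto (fun R => u R ^ 2) atTop atTop) :
    Tendsto (fun R : ℝ => ∫ b in (0 : ℝ)..1, airyPhase x (u R + b * Complex.I)) atTop (𝓝 0) := by
  have h := intervalIntegral.tendsto_integral_filter_of_dominated_convergence
    (μ := volume) (a := 0) (b := 1) (l := atTop) (f := fun _ => (0 : ℂ))
    (F := fun (R : ℝ) (b : ℝ) => airyPhase x (u R + b * Complex.I))
    (fun _ => Real.exp (1 / 3 + |x|))
    (Eventually.of_forall fun R => Continuous.aestronglyMeasurable (by fun_prop))
    (Eventually.of_forall fun R => ae_of_all _ fun b hb => ?_)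
    intervalIntegrable_const (ae_of_all _ fun b hb => ?_)
  · simpa using h
  · rw [Set.uIoc_of_le zero_le_one] at hb
    rw [norm_airyPhase, Real.exp_le_exp]
    have hb3 : b ^ 3 ≤ 1 := pow_le_one₀ hb.1.le hb.2
    have hxb : -(x * b) ≤ |x| := by
      refine (neg_le_abs _).trans ?_
      rw [abs_mul, abs_of_pos hb.1]
      exact mul_le_of_le_one_right (abs_nonneg x) hb.2
    nlinarith [mul_nonneg hb.1.le (sq_nonneg (u R))]
  · rw [Set.uIoc_of_le zero_le_one] at hb
    rw [tendsto_zero_iff_norm_tendsto_zero]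
    simp only [norm_airyPhase, add_sub_assoc]
    exact Real.tendsto_exp_atBot.comp (tendsto_atBot_add_const_right _ _
      (hu.const_mul_atTop_of_neg (neg_neg_of_pos hb.1)))

theorem tendsto_integral_airyPhase_real (x : ℝ) :
    Tendsto (fun R : ℝ => ∫ s in -R..R, airyPhase x s) atTop (𝓝 (airyMoment 0 x)) := by
  have hline : Tendsto (fun R : ℝ => ∫ s in -R..R, airyPhase x (s + Complex.I)) atTop
      (𝓝 (airyMoment 0 x)) := by
    have h := intervalIntegral_tendsto_integral
      (integrable_pow_mul_airyPhase (n := 0) (by norm_num) x) tendsto_neg_atTop_atBot tendsto_id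
    simpa [airyMoment] using h
  have hright := tendsto_integral_airyPhase_vertical x (u := fun R => R)
    (tendsto_pow_atTop two_ne_zero)
  have hleft := tendsto_integral_airyPhase_vertical x (u := fun R => -R)
    (by simp)
  have h := (hline.sub (hright.const_mul Complex.I)).add (hleft.const_mul Complex.I)
  rw [mul_zero, sub_zero, add_zero] at h
  refine h.congr fun R => ?_
  have hrect := Complex.integral_boundary_rect_eq_zero_of_differentiableOn (airyPhase x)
    ((-R : ℝ) : ℂ) ((R : ℂ) + Complex.I) (differentiable_airyPhase x).differentiableOn
  simp at hrect
  simp only [Complex.ofReal_neg]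
  linear_combination -hrect

theorem airyMoment_zero_re {x c : ℝ}
    (h : Tendsto (fun R : ℝ => ∫ t in (0 : ℝ)..R, Real.cos (t ^ 3 / 3 + x * t)) atTop (𝓝 c)) :
    (airyMoment 0 x).re = 2 * c := by
  have hre := (Complex.continuous_re.tendsto _).comp (tendsto_integral_airyPhase_real x)
  refine tendsto_nhds_unique hre ((h.const_mul 2).congr fun R => ?_)
  have hcos : Continuous fun t : ℝ => Real.cos (t ^ 3 / 3 + x * t) := by fun_prop
  have hint : IntervalIntegrable (fun s : ℝ => airyPhase x s) volume (-R) R :=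
    Continuous.intervalIntegrable (by fun_prop) _ _
  have hcomm := Complex.reCLM.intervalIntegral_comp_comm hint
  have hpt (s : ℝ) : (airyPhase x s).re = Real.cos (s ^ 3 / 3 + x * s) := by
    rw [airyPhase, mul_comm, ← Complex.exp_ofReal_mul_I_re]
    push_cast
    rfl
  simp only [Complex.reCLM_apply, hpt] at hcomm
  rw [Function.comp_apply, ← hcomm, ← intervalIntegral.integral_add_adjacent_intervals
    (hcos.intervalIntegrable (-R) 0) (hcos.intervalIntegrable 0 R), two_mul]
  congr 1
  have hneg := intervalIntegral.integral_comp_neg (a := 0) (b := R)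
    fun t : ℝ => Real.cos (t ^ 3 / 3 + x * t)
  rw [neg_zero] at hneg
  rw [← hneg]
  refine intervalIntegral.integral_congr fun t _ => ?_
  rw [← Real.cos_neg]
  congr 1
  ring

/-- Integral representation of the Christoffel–Darboux type kernel of a solution of the Airy
equation `f'' = x f` which, together with its derivative, decays exponentially at `+∞`. -/
theorem integral_Ioi_mul_of_airy_equation {f f' : ℝ → ℝ} {C : ℝ}
    (hf : ∀ x, HasDerivAt f (f' x) x) (hf' : ∀ x, HasDerivAt f' (x * f x) x)
    (hC : ∀ x, |f x| ≤ C * Real.exp (-x)) (hC' : ∀ x, |f' x| ≤ C * Real.exp (-x))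
    {x y : ℝ} (hxy : x ≠ y) :
    (f x * f' y - f y * f' x) / (x - y) = ∫ t in Set.Ioi (0 : ℝ), f (x + t) * f (y + t) := by
  have hfc : Continuous f := continuous_iff_continuousAt.2 fun x => (hf x).continuousAt
  have hbound {g h : ℝ → ℝ} (hg : ∀ x, |g x| ≤ C * Real.exp (-x))
      (hh : ∀ x, |h x| ≤ C * Real.exp (-x)) (x y t : ℝ) :
      ‖g (x + t) * h (y + t)‖ ≤ C ^ 2 * Real.exp (-(x + y)) * Real.exp (-2 * t) := by
    rw [norm_mul]
    refine (mul_le_mul (hg _) (hh _) (abs_nonneg _)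
      ((abs_nonneg _).trans (hg _))).trans_eq ?_
    rw [mul_mul_mul_comm, ← Real.exp_add, mul_assoc (C ^ 2), ← Real.exp_add, ← sq]
    congr 2
    ring
  have hlim {g h : ℝ → ℝ} (hg : ∀ x, |g x| ≤ C * Real.exp (-x))
      (hh : ∀ x, |h x| ≤ C * Real.exp (-x)) (x y : ℝ) :
      Tendsto (fun t => g (x + t) * h (y + t)) atTop (𝓝 0) := by
    refine squeeze_zero_norm (hbound hg hh x y) ?_
    have he : Tendsto (fun t : ℝ => Real.exp (-2 * t)) atTop (𝓝 0) :=
      Real.tendsto_exp_atBot.comp (tendsto_id.const_mul_atTop_of_neg (by norm_num))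
    simpa using he.const_mul (C ^ 2 * Real.exp (-(x + y)))
  have hint : IntegrableOn (fun t => f (x + t) * f (y + t)) (Set.Ioi 0) :=
    ((exp_neg_integrableOn_Ioi 0 two_pos).const_mul _).mono'
      (Continuous.aestronglyMeasurable (by fun_prop)) (ae_of_all _ (hbound hC hC x y))
  have hderiv : ∀ t ∈ Set.Ici (0 : ℝ),
      HasDerivAt (fun t => f (x + t) * f' (y + t) - f (y + t) * f' (x + t))
        ((y - x) * (f (x + t) * f (y + t))) t := by
    intro t _
    convert! (((hf (x + t)).comp_const_add x t).mul ((hf' (y + t)).comp_const_add y t)).sub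
      (((hf (y + t)).comp_const_add y t).mul ((hf' (x + t)).comp_const_add x t)) using 1
    ring
  have h := integral_Ioi_of_hasDerivAt_of_tendsto' hderiv (hint.const_mul _)
    ((hlim hC hC' x y).sub (hlim hC hC' y x))
  rw [integral_const_mul] at h
  simp only [add_zero] at h
  rw [div_eq_iff (sub_ne_zero.2 hxy)]
  linear_combination h

open MeasureTheory Filter in
/-- Integral representation of the Airy kernel:
`(Ai(x)Ai'(y) − Ai(y)Ai'(x))/(x−y) = ∫_0^∞ Ai(x+t) Ai(y+t) dt` for `x ≠ y`. -/
theorem airy_kernel_integral_representation (Ai : ℝ → ℝ)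
    (hAi : ∀ x : ℝ, Tendsto (fun R : ℝ => ∫ t in (0 : ℝ)..R, Real.cos (t ^ 3 / 3 + x * t))
      atTop (nhds (Real.pi * Ai x)))
    (x y : ℝ) (hxy : x ≠ y) :
    (Ai x * deriv Ai y - Ai y * deriv Ai x) / (x - y) =
      ∫ t in Set.Ioi (0 : ℝ), Ai (x + t) * Ai (y + t) := by
  have hre (x : ℝ) : Ai x = (airyMoment 0 x).re / (2 * Real.pi) := by
    rw [airyMoment_zero_re (hAi x)]
    field_simp
  have hAi_eq : Ai = fun x => (airyMoment 0 x).re / (2 * Real.pi) := funext hre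
  have hd (x : ℝ) : HasDerivAt Ai ((Complex.I * airyMoment 1 x).re / (2 * Real.pi)) x := by
    rw [hAi_eq]
    exact (Complex.reCLM.hasFDerivAt.comp_hasDerivAt x
      (hasDerivAt_airyMoment zero_le_one x)).div_const _
  have hd' (x : ℝ) : HasDerivAt (fun x => (Complex.I * airyMoment 1 x).re / (2 * Real.pi))
      (x * Ai x) x := by
    convert! (Complex.reCLM.hasFDerivAt.comp_hasDerivAt x
      ((hasDerivAt_airyMoment le_rfl x).const_mul Complex.I)).div_const (2 * Real.pi) using 1
    rw [hre, ← mul_assoc, Complex.I_mul_I, airyMoment_two]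
    simp
    ring
  obtain ⟨C, hC⟩ := exists_norm_airyMoment_le
  have hbound {z : ℂ} {x : ℝ} (hz : ‖z‖ ≤ C * Real.exp (-x)) :
      |z.re / (2 * Real.pi)| ≤ C / (2 * Real.pi) * Real.exp (-x) := by
    rw [abs_div, abs_of_pos Real.two_pi_pos, div_mul_eq_mul_div]
    gcongr
    exact (Complex.abs_re_le_norm z).trans hz
  rw [(hd x).deriv, (hd y).deriv]
  refine integral_Ioi_mul_of_airy_equation (C := C / (2 * Real.pi)) hd hd' (fun x => ?_)
    (fun x => hbound ?_) hxy
  · rw [hre]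
    exact hbound (hC 0 (by norm_num) x)
  · simpa using hC 1 (by norm_num) x
end
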